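/- arXiv:2107.13245 — 10 statements merged into one kernel-verified Lean document; each statement's English description precedes it below -/
import Mathlib

section
/- Let α, β be nonnegative integers with α + β ≥ 1 and let n ≥ 1. Then for every monic polynomial P with real coefficients of degree n, (1/π) ∫_{-1}^{1} P(x)² (1-x)^{α-1/2} (1+x)^{β-1/2} dx ≥ 2^{1-α-β-2n}. -/
open Polynomial MeasureTheory intervalIntegral Real

/-- The polynomial `Q` with `Q(z) = (2z)^d p((z + z⁻¹)/2)`, for `p` monic of degree `d`
given by its multiset of roots. -/
theorem exists_joukowski_lift (s : Multiset ℂ) :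
    ∃ Q : ℂ[X], Q.Monic ∧ Q.natDegree = 2 * s.card ∧ Q.coeff 0 = 1 ∧
      ∀ z : ℂ, z ≠ 0 → Q.eval z =
        (2 * z) ^ s.card * ((s.map fun a => X - C a).prod).eval ((z + z⁻¹) / 2) := by
  induction s using Multiset.induction_on with
  | empty => exact ⟨1, monic_one, by simp, by simp, by simp⟩
  | cons a s ih =>
    obtain ⟨Q, hmonic, hdeg, hcoeff, heval⟩ := ih
    have hq : (X ^ 2 - C (2 * a) * X + 1 : ℂ[X]).natDegree = 2 := by compute_degree!
    have hqm : (X ^ 2 - C (2 * a) * X + 1 : ℂ[X]).Monic := by monicity!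
    refine ⟨(X ^ 2 - C (2 * a) * X + 1) * Q, hqm.mul hmonic, ?_, ?_, fun z hz => ?_⟩
    · rw [hqm.natDegree_mul hmonic, hq, hdeg, Multiset.card_cons]
      ring
    · simp [mul_coeff_zero, hcoeff]
    · rw [eval_mul, heval z hz]
      simp only [Multiset.map_cons, Multiset.prod_cons, Multiset.card_cons, eval_mul, eval_add,
        eval_sub, eval_pow, eval_X, eval_C, eval_one, pow_succ (2 * z)]
      field_simp
      ring

theorem two_le_circleAverage_sq_norm_eval {Q : ℂ[X]} (hQ : Q.Monic) (hdeg : Q.natDegree ≠ 0)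
    (h0 : ‖Q.coeff 0‖ = 1) : 2 ≤ circleAverage (fun z => ‖Q.eval z‖ ^ 2) 0 1 := by
  rw [← sum_sq_norm_coeff_eq_circleAverage]
  have hsub : ({0, Q.natDegree} : Finset ℕ) ⊆ Q.support := by
    intro i hi
    rw [Finset.mem_insert, Finset.mem_singleton] at hi
    rw [mem_support_iff]
    rcases hi with rfl | rfl
    · exact norm_ne_zero_iff.mp (by simp [h0])
    · simp [hQ.coeff_natDegree]
  refine le_trans ?_ (Finset.sum_le_sum_of_subset_of_nonneg hsub fun i _ _ => sq_nonneg _)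
  rw [Finset.sum_pair hdeg.symm, h0, hQ.coeff_natDegree]
  norm_num

theorem integral_comp_cos_zero_two_pi {f : ℝ → ℝ} (hf : Continuous f) :
    ∫ θ in 0..2 * π, f (cos θ) = 2 * ∫ θ in 0..π, f (cos θ) := by
  have hint (a b : ℝ) : IntervalIntegrable (fun θ => f (cos θ)) volume a b :=
    (hf.comp continuous_cos).intervalIntegrable a b
  rw [← integral_add_adjacent_intervals (hint 0 π) (hint π (2 * π)), two_mul (∫ θ in 0..π, _)]
  congr 1
  have h := integral_comp_sub_left (a := 0) (b := π) (fun θ => f (cos θ)) (2 * π)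
  simp only [cos_two_pi_sub, sub_zero] at h
  rw [h]
  congr 1
  ring

theorem circleMap_add_inv_div_two (θ : ℝ) :
    (circleMap 0 1 θ + (circleMap 0 1 θ)⁻¹) / 2 = (cos θ : ℂ) := by
  simp [circleMap, Complex.cos, ← Complex.exp_neg]

theorem sq_norm_circleMap_sub_one (θ : ℝ) : ‖circleMap 0 1 θ - 1‖ ^ 2 = 2 * (1 - cos θ) := by
  rw [Complex.sq_norm, Complex.normSq_apply]
  simp only [circleMap, Complex.sub_re, Complex.sub_im, Complex.ofReal_one, one_mul, zero_add,
    Complex.exp_ofReal_mul_I_re, Complex.exp_ofReal_mul_I_im, Complex.one_re, Complex.one_im]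
  linear_combination sin_sq_add_cos_sq θ

theorem sq_norm_circleMap_add_one (θ : ℝ) : ‖circleMap 0 1 θ + 1‖ ^ 2 = 2 * (1 + cos θ) := by
  rw [Complex.sq_norm, Complex.normSq_apply]
  simp only [circleMap, Complex.add_re, Complex.add_im, Complex.ofReal_one, one_mul, zero_add,
    Complex.exp_ofReal_mul_I_re, Complex.exp_ofReal_mul_I_im, Complex.one_re, Complex.one_im]
  linear_combination sin_sq_add_cos_sq θ

theorem rpow_sub_half_mul_rpow_sub_half (a b : ℕ) {x : ℝ} (hx : x ∈ Set.Ioo (-1) 1) :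
    (1 - x) ^ ((a : ℝ) - 1 / 2) * (1 + x) ^ ((b : ℝ) - 1 / 2) =
      (1 - x) ^ a * (1 + x) ^ b * √(1 - x ^ 2)⁻¹ := by
  have h1 : 0 < 1 - x := by linarith [hx.2]
  have h2 : 0 < 1 + x := by linarith [hx.1]
  rw [rpow_sub h1, rpow_sub h2, rpow_natCast, rpow_natCast, ← sqrt_eq_rpow, ← sqrt_eq_rpow,
    show 1 - x ^ 2 = (1 - x) * (1 + x) by ring, sqrt_inv, sqrt_mul h1.le]
  field_simp

theorem widom_lower_bound_generalized_jacobi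
    (α β : ℕ) (hαβ : 1 ≤ α + β) (n : ℕ) (hn : 1 ≤ n)
    (P : ℝ[X]) (hP : P.Monic) (hdeg : P.natDegree = n) :
    (1 / π) * ∫ x in (-1:ℝ)..1,
        (P.eval x) ^ 2 * (1 - x) ^ ((α : ℝ) - 1/2) * (1 + x) ^ ((β : ℝ) - 1/2)
      ≥ (2 : ℝ) ^ ((1 : ℤ) - α - β - 2 * n) := by
  set f : ℝ → ℝ := fun x => P.eval x ^ 2 * ((1 - x) ^ α * (1 + x) ^ β) with hf
  have hint : ∫ x in (-1:ℝ)..1,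
      (P.eval x) ^ 2 * (1 - x) ^ ((α : ℝ) - 1/2) * (1 + x) ^ ((β : ℝ) - 1/2) =
      ∫ θ in 0..π, f (cos θ) := by
    rw [← Chebyshev.integral_measureT_eq_integral_cos, Chebyshev.integral_measureT]
    refine integral_congr_Ioo_of_le (by norm_num) fun x hx => ?_
    simp only [hf]
    rw [mul_assoc, rpow_sub_half_mul_rpow_sub_half α β hx]
    ring
  set p : ℂ[X] := P.map Complex.ofRealHom with hp
  have hpm : p.Monic := hP.map _
  have hprod := (IsAlgClosed.splits p).eq_prod_roots_of_monic hpm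
  have hcard : p.roots.card = n := by
    rw [← (IsAlgClosed.splits p).natDegree_eq_card_roots, hp, hP.natDegree_map, hdeg]
  obtain ⟨Q, hQ, hQdeg, hQ0, hQeval⟩ := exists_joukowski_lift p.roots
  rw [hcard] at hQdeg hQeval
  rw [← hprod] at hQeval
  have hα : ((X - C 1 : ℂ[X]) ^ α).Monic := (monic_X_sub_C _).pow _
  have hβ : ((X + C 1 : ℂ[X]) ^ β).Monic := (monic_X_add_C _).pow _
  have key := two_le_circleAverage_sq_norm_eval ((hQ.mul hα).mul hβ)
    (by rw [(hQ.mul hα).natDegree_mul hβ, hQ.natDegree_mul hα]; omega)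
    (by simp [mul_coeff_zero, coeff_zero_eq_eval_zero (_ ^ _), hQ0])
  have hnorm (θ : ℝ) : ‖(Q * (X - C 1) ^ α * (X + C 1) ^ β).eval (circleMap 0 1 θ)‖ ^ 2 =
      2 ^ (2 * n + α + β) * f (cos θ) := by
    have hQn : ‖Q.eval (circleMap 0 1 θ)‖ ^ 2 = 2 ^ (2 * n) * P.eval (cos θ) ^ 2 := by
      have hreal : p.eval (cos θ : ℂ) = (P.eval (cos θ) : ℝ) := by
        simpa using (eval_map_apply (f := Complex.ofRealHom) (p := P) (cos θ))
      rw [hQeval _ (circleMap_ne_center one_ne_zero), circleMap_add_inv_div_two, hreal]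
      simp [mul_pow, ← pow_mul, mul_comm]
    simp only [eval_mul, eval_pow, eval_sub, eval_add, eval_X, eval_C, norm_mul, norm_pow, mul_pow]
    rw [hQn, pow_right_comm, sq_norm_circleMap_sub_one, pow_right_comm, sq_norm_circleMap_add_one,
      mul_pow 2, mul_pow 2]
    simp only [hf]
    ring
  rw [circleAverage_def] at key
  simp only [hnorm, smul_eq_mul, intervalIntegral.integral_const_mul] at key
  rw [integral_comp_cos_zero_two_pi (by fun_prop)] at key
  rw [hint, ge_iff_le,
    show (1 : ℤ) - α - β - 2 * n = 1 - ((2 * n + α + β : ℕ) : ℤ) by push_cast; ring,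
    zpow_sub₀ two_ne_zero, zpow_one, zpow_natCast, div_le_iff₀ (by positivity)]
  refine key.trans_eq ?_
  field_simp
end

section
/- Let n ≥ 1. For every monic polynomial P with real coefficients of degree n, (1/π) ∫_{-1}^{1} P(x)² (1-x)^{1/2} (1+x)^{-1/2} dx ≥ 4^{-n}, with equality if and only if P = 2^{-n} (U_n + U_{n-1}), where U_k is the Chebyshev polynomial of the second kind. -/
open Polynomial MeasureTheory intervalIntegral Real Polynomial.Chebyshev

theorem integrable_eval_measureT (Q : ℝ[X]) : Integrable (fun x ↦ Q.eval x) measureT :=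
  integrable_measureT Q.continuous.continuousOn

theorem integral_eval_add_measureT (Q R : ℝ[X]) :
    ∫ x, (Q + R).eval x ∂measureT = ∫ x, Q.eval x ∂measureT + ∫ x, R.eval x ∂measureT := by
  simp_rw [eval_add]
  exact integral_add (integrable_eval_measureT Q) (integrable_eval_measureT R)

theorem integral_eval_sub_measureT (Q R : ℝ[X]) :
    ∫ x, (Q - R).eval x ∂measureT = ∫ x, Q.eval x ∂measureT - ∫ x, R.eval x ∂measureT := by
  simp_rw [eval_sub]
  exact integral_sub (integrable_eval_measureT Q) (integrable_eval_measureT R)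

theorem integral_eval_C_mul_measureT (a : ℝ) (Q : ℝ[X]) :
    ∫ x, (Polynomial.C a * Q).eval x ∂measureT = a * ∫ x, Q.eval x ∂measureT := by
  simp_rw [eval_C_mul]
  exact integral_const_mul a _

/-- `T_n` is orthogonal to every polynomial of degree less than `n`. -/
theorem integral_eval_T_mul_of_degree_lt {n : ℕ} {Q : ℝ[X]} (hQ : Q.degree < n) :
    ∫ x, (T ℝ n * Q).eval x ∂measureT = 0 := by
  rw [← mem_degreeLT, ← Sequence.span_degreeLT (chebyshevTsequence ℝ) (by simp)] at hQ
  induction hQ using Submodule.span_induction with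
  | mem Q h =>
    obtain ⟨m, hm, rfl⟩ := h
    simpa [chebyshevTsequence] using
      integral_eval_T_real_mul_eval_T_real_measureT_of_ne (n := n) (m := m)
        (ne_of_gt (by simpa using hm))
  | zero => simp
  | add Q R _ _ hQ hR => rw [mul_add, integral_eval_add_measureT, hQ, hR, add_zero]
  | smul a Q _ hQ =>
    rw [smul_eq_C_mul, mul_left_comm, integral_eval_C_mul_measureT, hQ, mul_zero]

theorem integral_eval_T_mul_of_monic {n : ℕ} (hn : 1 ≤ n) {P : ℝ[X]} (hP : P.Monic)
    (hdeg : P.natDegree = n) :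
    ∫ x, (T ℝ n * P).eval x ∂measureT = π / 2 ^ n := by
  obtain ⟨m, rfl⟩ : ∃ m, n = m + 1 := ⟨n - 1, by omega⟩
  set S : ℝ[X] := Polynomial.C ((2 ^ m : ℝ)⁻¹) * T ℝ (m + 1 : ℕ) with hS
  have hc : (2 ^ m : ℝ)⁻¹ ≠ 0 := by positivity
  have hPd : P.degree = (m + 1 : ℕ) := (degree_eq_iff_natDegree_eq hP.ne_zero).2 hdeg
  have hSd : S.degree = (m + 1 : ℕ) := by
    rw [hS, degree_C_mul hc, degree_T, Int.natAbs_natCast]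
  have hSl : S.leadingCoeff = 1 := by
    rw [hS, leadingCoeff_mul, leadingCoeff_C, leadingCoeff_T, Int.natAbs_natCast,
      Nat.add_sub_cancel, inv_mul_cancel₀ (by positivity)]
  have hlt : (P - S).degree < (m + 1 : ℕ) := by
    rw [← hPd]
    exact degree_sub_lt_left (hPd.trans hSd.symm) hP.ne_zero (hP.leadingCoeff.trans hSl.symm)
  have hTT : ∫ x, (T ℝ (m + 1 : ℕ) * T ℝ (m + 1 : ℕ)).eval x ∂measureT = π / 2 := by
    simp_rw [eval_mul]
    exact integral_T_real_mul_self_measureT_of_ne_zero m.succ_ne_zero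
  have hdec : T ℝ (m + 1 : ℕ) * P = T ℝ (m + 1 : ℕ) * (P - S) +
      Polynomial.C ((2 ^ m : ℝ)⁻¹) * (T ℝ (m + 1 : ℕ) * T ℝ (m + 1 : ℕ)) := by
    rw [hS]; ring
  rw [hdec, integral_eval_add_measureT, integral_eval_C_mul_measureT, hTT,
    integral_eval_T_mul_of_degree_lt hlt, pow_succ]
  field_simp
  ring

/-- The monic multiple of the Chebyshev polynomial of the fourth kind. -/
noncomputable def monicFourthKind (n : ℕ) : ℝ[X] :=
  Polynomial.C (((2 : ℝ) ^ n)⁻¹) * (U ℝ n + U ℝ ((n : ℤ) - 1))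

theorem degree_U_natCast_sub_one_lt (n : ℕ) : (U ℝ ((n : ℤ) - 1)).degree < (U ℝ n).degree := by
  cases n with
  | zero => simp
  | succ m =>
    rw [show ((m + 1 : ℕ) : ℤ) - 1 = m by simp, degree_U_natCast, degree_U_natCast]
    exact_mod_cast m.lt_succ_self

theorem natDegree_monicFourthKind (n : ℕ) : (monicFourthKind n).natDegree = n := by
  rw [monicFourthKind, natDegree_C_mul (by positivity),
    natDegree_add_eq_left_of_degree_lt (degree_U_natCast_sub_one_lt n), natDegree_U_natCast]

theorem monic_monicFourthKind (n : ℕ) : (monicFourthKind n).Monic := by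
  rw [Monic, monicFourthKind, leadingCoeff_mul, leadingCoeff_C,
    leadingCoeff_add_of_degree_lt' (degree_U_natCast_sub_one_lt n), leadingCoeff_U_natCast]
  field_simp

theorem one_sub_X_mul_monicFourthKind (n : ℕ) :
    (1 - X) * monicFourthKind n =
      Polynomial.C (((2 : ℝ) ^ n)⁻¹) * (T ℝ n - T ℝ (n + 1 : ℕ)) := by
  have h₁ := T_eq_U_sub_X_mul_U ℝ n
  have h₂ := T_eq_X_mul_U_sub_U ℝ ((n : ℤ) - 1)
  rw [show (n : ℤ) - 1 + 2 = (n + 1 : ℕ) by push_cast; ring, sub_add_cancel] at h₂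
  rw [monicFourthKind, h₁, h₂]
  ring

theorem integral_one_sub_X_mul_monicFourthKind_mul {n : ℕ} (hn : 1 ≤ n) {P : ℝ[X]}
    (hP : P.Monic) (hdeg : P.natDegree = n) :
    ∫ x, ((1 - X) * monicFourthKind n * P).eval x ∂measureT = π * ((4 : ℝ) ^ n)⁻¹ := by
  have hlt : P.degree < (n + 1 : ℕ) :=
    (natDegree_lt_iff_degree_lt hP.ne_zero).1 (by omega)
  rw [one_sub_X_mul_monicFourthKind, mul_assoc, integral_eval_C_mul_measureT, sub_mul,
    integral_eval_sub_measureT, integral_eval_T_mul_of_monic hn hP hdeg,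
    integral_eval_T_mul_of_degree_lt hlt, show (4 : ℝ) = 2 * 2 by norm_num, mul_pow]
  field_simp
  ring

theorem integral_one_sub_X_mul_sq (Q : ℝ[X]) :
    ∫ x, ((1 - X) * Q ^ 2).eval x ∂measureT =
      ∫ θ in (0 : ℝ)..π, (1 - cos θ) * Q.eval (cos θ) ^ 2 := by
  rw [integral_measureT_eq_integral_cos]
  simp

theorem integral_one_sub_X_mul_sq_nonneg (Q : ℝ[X]) :
    0 ≤ ∫ x, ((1 - X) * Q ^ 2).eval x ∂measureT := by
  rw [integral_one_sub_X_mul_sq]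
  exact integral_nonneg pi_nonneg fun θ _ ↦
    mul_nonneg (sub_nonneg.2 (cos_le_one θ)) (sq_nonneg _)

theorem integral_one_sub_X_mul_sq_eq_zero_iff (Q : ℝ[X]) :
    ∫ x, ((1 - X) * Q ^ 2).eval x ∂measureT = 0 ↔ Q = 0 := by
  refine ⟨fun h ↦ ?_, fun h ↦ by simp [h]⟩
  refine eq_zero_of_infinite_isRoot Q ((Set.Ico_infinite (show (-1 : ℝ) < 1 by norm_num)).mono ?_)
  intro x hx
  by_contra hroot
  refine (ne_of_gt ?_) h
  rw [integral_one_sub_X_mul_sq]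
  refine intervalIntegral.integral_pos pi_pos ?_
    (fun θ _ ↦ mul_nonneg (sub_nonneg.2 (cos_le_one θ)) (sq_nonneg _))
    ⟨arccos x, ⟨arccos_nonneg x, arccos_le_pi x⟩, ?_⟩
  · have := Q.continuous
    fun_prop
  · rw [cos_arccos hx.1 hx.2.le]
    have : Q.eval x ≠ 0 := hroot
    exact mul_pos (sub_pos.2 hx.2) (by positivity)

theorem integral_fourthKind_weight (P : ℝ[X]) :
    ∫ x in (-1:ℝ)..1, (P.eval x) ^ 2 * (1 - x) ^ ((1:ℝ)/2) * (1 + x) ^ (-(1:ℝ)/2) =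
      ∫ x, ((1 - X) * P ^ 2).eval x ∂measureT := by
  rw [integral_measureT]
  refine integral_congr_ae (ae_of_all _ fun x hx ↦ ?_)
  rw [Set.uIoc_of_le (by norm_num)] at hx
  have hp : 0 < 1 + x := by linarith [hx.1]
  have hm : 0 ≤ 1 - x := sub_nonneg.2 hx.2
  have hfac : (1 : ℝ) - x ^ 2 = (1 - x) * (1 + x) := by ring
  rw [neg_div, rpow_neg hp.le, ← sqrt_eq_rpow, ← sqrt_eq_rpow, sqrt_inv, hfac, sqrt_mul hm]
  simp only [eval_mul, eval_sub, eval_one, eval_X, eval_pow]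
  have hs : √(1 - x) * √(1 - x) = 1 - x := mul_self_sqrt hm
  rcases eq_or_ne (√(1 - x)) 0 with h0 | h0
  · rw [← hs, h0]; simp
  · have : √(1 + x) ≠ 0 := (sqrt_pos.2 hp).ne'
    field_simp
    linear_combination P.eval x ^ 2 * hs

theorem integral_one_sub_X_mul_sq_of_monic {n : ℕ} (hn : 1 ≤ n) {P : ℝ[X]} (hP : P.Monic)
    (hdeg : P.natDegree = n) :
    ∫ x, ((1 - X) * P ^ 2).eval x ∂measureT =
      π * ((4 : ℝ) ^ n)⁻¹ + ∫ x, ((1 - X) * (P - monicFourthKind n) ^ 2).eval x ∂measureT := by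
  have hdec : (1 - X) * P ^ 2 = (1 - X) * monicFourthKind n * P +
      ((1 - X) * monicFourthKind n * P - (1 - X) * monicFourthKind n * monicFourthKind n) +
      (1 - X) * (P - monicFourthKind n) ^ 2 := by ring
  rw [hdec, integral_eval_add_measureT, integral_eval_add_measureT, integral_eval_sub_measureT,
    integral_one_sub_X_mul_monicFourthKind_mul hn hP hdeg,
    integral_one_sub_X_mul_monicFourthKind_mul hn (monic_monicFourthKind n)
      (natDegree_monicFourthKind n)]
  ring

theorem monic_chebyshev_fourth_kind_L2_optimal (n : ℕ) (hn : 1 ≤ n)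
    (P : ℝ[X]) (hP : P.Monic) (hdeg : P.natDegree = n) :
    (1 / π) * ∫ x in (-1:ℝ)..1,
        (P.eval x) ^ 2 * (1 - x) ^ ((1:ℝ)/2) * (1 + x) ^ (-(1:ℝ)/2)
      ≥ ((4 : ℝ) ^ n)⁻¹ ∧
    ((1 / π) * ∫ x in (-1:ℝ)..1,
          (P.eval x) ^ 2 * (1 - x) ^ ((1:ℝ)/2) * (1 + x) ^ (-(1:ℝ)/2)
        = ((4 : ℝ) ^ n)⁻¹ ↔
      P = C (((2 : ℝ) ^ n)⁻¹) * (Chebyshev.U ℝ n + Chebyshev.U ℝ ((n : ℤ) - 1))) := by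
  rw [integral_fourthKind_weight, integral_one_sub_X_mul_sq_of_monic hn hP hdeg, mul_add,
    ← mul_assoc, one_div_mul_cancel pi_ne_zero, one_mul]
  refine ⟨le_add_of_nonneg_right (mul_nonneg (by positivity)
    (integral_one_sub_X_mul_sq_nonneg _)), ?_⟩
  rw [add_eq_left, mul_eq_zero_iff_left (one_div_ne_zero pi_ne_zero),
    integral_one_sub_X_mul_sq_eq_zero_iff, sub_eq_zero, monicFourthKind]
end

section
/- Let n ≥ 1. For every monic polynomial P with real coefficients of degree n, sup_{x ∈ [-1,1]} √(1-x²) |P(x)| ≥ 2^{-n}, and equality holds for P = 2^{-n} U_n, where U_k is the Chebyshev polynomial of the second kind. -/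
open Polynomial Real Polynomial.Chebyshev

theorem bddAbove_range_sqrt_one_sub_sq_mul_abs_eval (P : ℝ[X]) :
    BddAbove (Set.range fun x : Set.Icc (-1 : ℝ) 1 =>
      Real.sqrt (1 - (x : ℝ) ^ 2) * |P.eval (x : ℝ)|) :=
  (isCompact_range (by fun_prop)).bddAbove

theorem coeff_one_sub_C_mul_one_sub_X_sq_mul_sq {P : ℝ[X]} (hP : P.Monic) (c : ℝ) :
    (1 - Polynomial.C c * ((1 - X ^ 2) * P ^ 2)).coeff (2 * P.natDegree + 2) = c := by
  have h₁ : (P ^ 2).coeff (2 * P.natDegree) = 1 := by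
    rw [← hP.natDegree_pow 2]
    exact (hP.pow 2).coeff_natDegree
  have h₂ : (P ^ 2).coeff (2 * P.natDegree + 2) = 0 := by
    apply coeff_eq_zero_of_natDegree_lt
    rw [hP.natDegree_pow]
    lia
  rw [sub_mul, one_mul, coeff_sub, coeff_C_mul, coeff_sub, coeff_X_pow_mul, h₁, h₂, coeff_one]
  simp

theorem inv_two_pow_le_of_forall_sqrt_one_sub_sq_mul_abs_eval_le {P : ℝ[X]} (hP : P.Monic)
    {M : ℝ} (hM : 0 < M)
    (h : ∀ x ∈ Set.Icc (-1 : ℝ) 1, Real.sqrt (1 - x ^ 2) * |P.eval x| ≤ M) :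
    ((2 : ℝ) ^ P.natDegree)⁻¹ ≤ M := by
  set Q : ℝ[X] := 1 - Polynomial.C (2 / M ^ 2) * ((1 - X ^ 2) * P ^ 2) with hQ
  have hdeg : Q.degree ≤ (2 * P.natDegree + 2 : ℕ) := by
    apply degree_le_of_natDegree_le
    rw [hQ]
    compute_degree
    lia
  have hbound : ∀ x ∈ Set.Icc (-1 : ℝ) 1, |Q.eval x| ≤ 1 := by
    intro x hx
    have hx2 : 0 ≤ 1 - x ^ 2 := by nlinarith [hx.1, hx.2]
    have hle : (1 - x ^ 2) * P.eval x ^ 2 ≤ M ^ 2 := by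
      have := pow_le_pow_left₀ (by positivity) (h x hx) 2
      rwa [mul_pow, Real.sq_sqrt hx2, sq_abs] at this
    have hscaled : 2 / M ^ 2 * ((1 - x ^ 2) * P.eval x ^ 2) ≤ 2 := by
      rw [div_mul_eq_mul_div, div_le_iff₀ (by positivity)]
      linarith
    have hnonneg : 0 ≤ 2 / M ^ 2 * ((1 - x ^ 2) * P.eval x ^ 2) := by positivity
    have heval : Q.eval x = 1 - 2 / M ^ 2 * ((1 - x ^ 2) * P.eval x ^ 2) := by
      simp [hQ]
    rw [heval, abs_le]
    constructor <;> linarith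
  have hcoeff := coeff_le_of_forall_abs_le_one hdeg hbound
  rw [hQ, coeff_one_sub_C_mul_one_sub_X_sq_mul_sq hP, div_le_iff₀ (by positivity),
    show 2 * P.natDegree + 2 - 1 = P.natDegree * 2 + 1 by lia, pow_succ, pow_mul] at hcoeff
  rw [inv_le_iff_one_le_mul₀ (by positivity)]
  refine (one_le_sq_iff₀ (by positivity)).mp ?_
  rw [mul_pow]
  linarith

theorem inv_two_pow_le_iSup_sqrt_one_sub_sq_mul_abs_eval {P : ℝ[X]} (hP : P.Monic) :
    ((2 : ℝ) ^ P.natDegree)⁻¹ ≤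
      ⨆ x : Set.Icc (-1 : ℝ) 1, Real.sqrt (1 - (x : ℝ) ^ 2) * |P.eval (x : ℝ)| := by
  refine le_of_forall_gt_imp_ge_of_dense fun M hM => ?_
  refine inv_two_pow_le_of_forall_sqrt_one_sub_sq_mul_abs_eval_le hP
    ((Real.iSup_nonneg fun x => by positivity).trans_lt hM) fun x hx => ?_
  exact (le_ciSup (bddAbove_range_sqrt_one_sub_sq_mul_abs_eval P) ⟨x, hx⟩).trans hM.le

theorem sqrt_one_sub_sq_mul_abs_eval_U_le_one (n : ℤ) {x : ℝ} (hx : x ∈ Set.Icc (-1 : ℝ) 1) :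
    Real.sqrt (1 - x ^ 2) * |(U ℝ n).eval x| ≤ 1 := by
  rw [← Real.cos_arccos hx.1 hx.2, ← Real.abs_sin_eq_sqrt_one_sub_cos_sq, ← abs_mul, mul_comm,
    U_real_cos]
  exact Real.abs_sin_le_one _

theorem natDegree_C_inv_two_pow_mul_U (n : ℕ) :
    (Polynomial.C (((2 : ℝ) ^ n)⁻¹) * U ℝ n).natDegree = n := by
  rw [natDegree_C_mul (by positivity), natDegree_U_natCast]

theorem monic_C_inv_two_pow_mul_U (n : ℕ) :
    (Polynomial.C (((2 : ℝ) ^ n)⁻¹) * U ℝ n).Monic :=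
  monic_C_mul_of_mul_leadingCoeff_eq_one (by rw [leadingCoeff_U_natCast]; field_simp)

theorem chebyshev_second_kind_weighted_sup_optimal (n : ℕ) (hn : 1 ≤ n) :
    (∀ P : ℝ[X], P.Monic → P.natDegree = n →
      (2 : ℝ) ^ (-(n : ℤ)) ≤
        ⨆ x : Set.Icc (-1:ℝ) 1, Real.sqrt (1 - (x : ℝ) ^ 2) * |P.eval (x : ℝ)|) ∧
    (⨆ x : Set.Icc (-1:ℝ) 1,
        Real.sqrt (1 - (x : ℝ) ^ 2) *
          |(C (((2 : ℝ) ^ n)⁻¹) * Chebyshev.U ℝ n).eval (x : ℝ)|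
      = (2 : ℝ) ^ (-(n : ℤ))) := by
  rw [zpow_neg, zpow_natCast]
  refine ⟨fun P hP hdeg => hdeg ▸ inv_two_pow_le_iSup_sqrt_one_sub_sq_mul_abs_eval hP,
    le_antisymm ?_ ?_⟩
  · have : Nonempty (Set.Icc (-1 : ℝ) 1) := ⟨⟨0, by norm_num⟩⟩
    refine ciSup_le fun x => ?_
    rw [eval_mul, eval_C, abs_mul, abs_of_pos (by positivity : (0 : ℝ) < (2 ^ n)⁻¹),
      mul_left_comm]
    exact mul_le_of_le_one_right (by positivity) (sqrt_one_sub_sq_mul_abs_eval_U_le_one n x.2)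
  · have := inv_two_pow_le_iSup_sqrt_one_sub_sq_mul_abs_eval (monic_C_inv_two_pow_mul_U n)
    rwa [natDegree_C_inv_two_pow_mul_U] at this
end

section
/- Let n ≥ 1. For every monic polynomial P with real coefficients of degree n, sup_{x ∈ [-1,1]} √(1+x) |P(x)| ≥ √2 · 2^{-n}, and equality holds for P = 2^{-n} (U_n - U_{n-1}), where U_k is the Chebyshev polynomial of the second kind. -/
open Polynomial Real Polynomial.Chebyshev

/-- A real polynomial of degree at most `n` bounded by `m > 0` on `[-1, 1]` has `n`-th coefficient
at most `m * 2 ^ (n - 1)`. -/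
theorem coeff_le_mul_of_forall_abs_le {n : ℕ} {P : ℝ[X]} {m : ℝ} (hm : 0 < m)
    (hdeg : P.degree ≤ n) (hbnd : ∀ x ∈ Set.Icc (-1 : ℝ) 1, |P.eval x| ≤ m) :
    P.coeff n ≤ m * 2 ^ (n - 1) := by
  have h := coeff_le_of_forall_abs_le_one (n := n) (P := Polynomial.C m⁻¹ * P)
    ((degree_C_mul (inv_pos.2 hm).ne').trans_le hdeg) (fun x hx => by
      rw [eval_mul, eval_C, abs_mul, abs_of_pos (inv_pos.2 hm), inv_mul_le_iff₀ hm, mul_one]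
      exact hbnd x hx)
  rwa [coeff_C_mul, inv_mul_le_iff₀ hm] at h

theorem mul_eval_U_sub_U (n : ℕ) (y : ℝ) :
    y * (U ℝ n - U ℝ ((n : ℤ) - 1)).eval (2 * y ^ 2 - 1) = (T ℝ (2 * n + 1)).eval y := by
  induction n using Nat.twoStepInduction with
  | zero => simp
  | one =>
    have h : T ℝ 3 = 2 * X * T ℝ 2 - T ℝ 1 := T_add_two ℝ 1
    simp [h, T_two]
    ring
  | more n h₀ h₁ =>
    have hT : 2 * T ℝ 2 * T ℝ (2 * n + 3) = T ℝ (2 * n + 5) + T ℝ (2 * n + 1) := by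
      rw [T_mul_T, add_comm (T ℝ (2 + (2 * n + 3))), add_comm]
      congr 1
      · congr 1; ring
      · rw [← T_neg]; congr 1
    have hU : U ℝ (n + 2) = 2 * X * U ℝ (n + 1) - U ℝ n := U_add_two ℝ n
    have hU' : U ℝ (n + 1) = 2 * X * U ℝ n - U ℝ (n - 1) := U_add_one ℝ n
    have e := congrArg (eval y) hT
    have eU := congrArg (eval (2 * y ^ 2 - 1)) hU
    have eU' := congrArg (eval (2 * y ^ 2 - 1)) hU'
    simp only [T_two, eval_mul, eval_add, eval_sub, eval_pow, eval_X, eval_ofNat, eval_one]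
      at e eU eU'
    push_cast at h₁ ⊢
    rw [show (n : ℤ) + 1 - 1 = n by ring, show 2 * ((n : ℤ) + 1) + 1 = 2 * n + 3 by ring] at h₁
    rw [show (n : ℤ) + 2 - 1 = n + 1 by ring, show 2 * ((n : ℤ) + 2) + 1 = 2 * n + 5 by ring]
    simp only [eval_sub] at h₀ h₁ ⊢
    linear_combination e + y * eU - y * eU' - h₀ + 2 * (2 * y ^ 2 - 1) * h₁

theorem sqrt_one_add_two_mul_sq_sub_one (y : ℝ) :
    √(1 + (2 * y ^ 2 - 1)) = √2 * |y| := by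
  rw [show 1 + (2 * y ^ 2 - 1) = 2 * y ^ 2 by ring, sqrt_mul (by norm_num), sqrt_sq_eq_abs]

theorem inv_two_pow_le_of_forall_sqrt_mul_abs_eval_le {n : ℕ} {P : ℝ[X]} (hP : P.Monic)
    (hn : P.natDegree = n) {m : ℝ} (hm : 0 < m)
    (hbnd : ∀ x ∈ Set.Icc (-1 : ℝ) 1, √(1 + x) * |P.eval x| ≤ √2 * m) :
    ((2 : ℝ) ^ n)⁻¹ ≤ m := by
  have hq : (2 * X ^ 2 - 1 : ℝ[X]) = Polynomial.C 2 * X ^ 2 - Polynomial.C 1 := rfl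
  have hqd : (2 * X ^ 2 - 1 : ℝ[X]).natDegree = 2 := by rw [hq]; compute_degree!
  have hql : (2 * X ^ 2 - 1 : ℝ[X]).leadingCoeff = 2 := by
    rw [leadingCoeff, hqd, hq]; simp [coeff_one]
  have hcd : (P.comp (2 * X ^ 2 - 1)).natDegree = 2 * n := by
    rw [natDegree_comp, hqd, hn, mul_comm]
  have hcl : (P.comp (2 * X ^ 2 - 1)).coeff (2 * n) = 2 ^ n := by
    rw [← hcd, coeff_natDegree, leadingCoeff_comp (by rw [hqd]; norm_num), hql, hP.leadingCoeff,
      hn, one_mul]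
  have h := coeff_le_mul_of_forall_abs_le (n := 2 * n + 1) (P := X * P.comp (2 * X ^ 2 - 1)) hm
    (by
      refine degree_le_of_natDegree_le (natDegree_mul_le.trans ?_)
      rw [hcd, natDegree_X, add_comm])
    (fun y hy => by
      have hy2 : y ^ 2 ≤ 1 := by nlinarith [hy.1, hy.2]
      have := hbnd (2 * y ^ 2 - 1) ⟨by nlinarith [sq_nonneg y], by linarith⟩
      rw [sqrt_one_add_two_mul_sq_sub_one, mul_assoc] at this
      have := le_of_mul_le_mul_left this (by positivity)
      simpa [abs_mul, eval_comp] using this)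
  rw [coeff_X_mul, hcl, Nat.add_sub_cancel, two_mul, pow_add, ← mul_assoc] at h
  rw [inv_le_iff_one_le_mul₀ (by positivity)]
  exact le_of_mul_le_mul_right (by simpa using h) (by positivity : (0 : ℝ) < 2 ^ n)

theorem sqrt_one_add_mul_abs_eval_U_sub_U_le (n : ℕ) {x : ℝ} (hx : x ∈ Set.Icc (-1 : ℝ) 1) :
    √(1 + x) * |(U ℝ n - U ℝ ((n : ℤ) - 1)).eval x| ≤ √2 := by
  obtain ⟨y, hy, rfl⟩ : ∃ y : ℝ, |y| ≤ 1 ∧ 2 * y ^ 2 - 1 = x := by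
    refine ⟨√((1 + x) / 2), ?_, ?_⟩
    · rw [abs_of_nonneg (sqrt_nonneg _), sqrt_le_one]
      linarith [hx.2]
    · rw [sq_sqrt (by linarith [hx.1])]
      ring
  rw [sqrt_one_add_two_mul_sq_sub_one, mul_assoc, ← abs_mul, mul_eval_U_sub_U]
  exact mul_le_of_le_one_right (sqrt_nonneg _) (abs_eval_T_real_le_one _ hy)

theorem chebyshev_third_kind_weighted_sup_optimal (n : ℕ) (hn : 1 ≤ n) :
    (∀ P : ℝ[X], P.Monic → P.natDegree = n →
      Real.sqrt 2 * (2 : ℝ) ^ (-(n : ℤ)) ≤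
        ⨆ x : Set.Icc (-1:ℝ) 1, Real.sqrt (1 + (x : ℝ)) * |P.eval (x : ℝ)|) ∧
    (⨆ x : Set.Icc (-1:ℝ) 1,
        Real.sqrt (1 + (x : ℝ)) *
          |(C (((2 : ℝ) ^ n)⁻¹) *
              (Chebyshev.U ℝ n - Chebyshev.U ℝ ((n : ℤ) - 1))).eval (x : ℝ)|
      = Real.sqrt 2 * (2 : ℝ) ^ (-(n : ℤ))) := by
  rw [zpow_neg, zpow_natCast]
  have h2 : (0 : ℝ) < √2 := by positivity
  constructor
  · intro P hP hdeg
    set M := ⨆ x : Set.Icc (-1:ℝ) 1, √(1 + (x : ℝ)) * |P.eval (x : ℝ)| with hM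
    have hbdd : BddAbove (Set.range fun x : Set.Icc (-1:ℝ) 1 =>
        √(1 + (x : ℝ)) * |P.eval (x : ℝ)|) :=
      (isCompact_range (by fun_prop)).bddAbove
    have hM0 : 0 ≤ M := Real.iSup_nonneg fun x => by positivity
    refine le_of_forall_pos_le_add fun ε hε => ?_
    rw [← le_div_iff₀' h2]
    refine inv_two_pow_le_of_forall_sqrt_mul_abs_eval_le hP hdeg (by positivity) fun x hx => ?_
    rw [mul_div_cancel₀ _ h2.ne']
    exact (le_ciSup hbdd ⟨x, hx⟩).trans (by linarith)
  · have hle : ∀ x : Set.Icc (-1:ℝ) 1, √(1 + (x : ℝ)) *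
        |(C (((2 : ℝ) ^ n)⁻¹) * (U ℝ n - U ℝ ((n : ℤ) - 1))).eval (x : ℝ)| ≤
          √2 * ((2 : ℝ) ^ n)⁻¹ := fun x => by
      rw [eval_mul, eval_C, abs_mul, abs_of_pos (by positivity), mul_left_comm, mul_comm √2]
      gcongr
      exact sqrt_one_add_mul_abs_eval_U_sub_U_le n x.2
    have : Nonempty (Set.Icc (-1:ℝ) 1) := ⟨⟨1, by norm_num⟩⟩
    refine le_antisymm (ciSup_le hle) ?_
    refine le_ciSup_of_le ⟨_, Set.forall_mem_range.2 hle⟩ ⟨1, by norm_num⟩ (le_of_eq ?_)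
    rw [eval_mul, eval_C, eval_sub, U_eval_one, U_eval_one]
    push_cast
    rw [show (n : ℝ) + 1 - (n - 1 + 1) = 1 by ring, mul_one, abs_of_pos (by positivity),
      one_add_one_eq_two]
end

section
/- Let n ≥ 1. For every monic polynomial P with real coefficients of degree n, sup_{x ∈ [-1,1]} √(1-x) |P(x)| ≥ √2 · 2^{-n}, and equality holds for P = 2^{-n} (U_n + U_{n-1}), where U_k is the Chebyshev polynomial of the second kind. -/
open Polynomial Real Polynomial.Chebyshev

theorem bddAbove_range_sqrt_one_sub_mul_abs_eval (P : ℝ[X]) :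
    BddAbove (Set.range fun x : Set.Icc (-1 : ℝ) 1 =>
      Real.sqrt (1 - (x : ℝ)) * |P.eval (x : ℝ)|) :=
  (isCompact_range (by fun_prop)).bddAbove

/-- If a monic polynomial `P` satisfies `√(1 - x) |P x| ≤ M` on `[-1, 1]`, then
`y ↦ y P (1 - 2 y ^ 2)` is bounded by `M / √2` on `[-1, 1]`, so the extremal property of the
Chebyshev polynomials of the first kind bounds its leading coefficient. -/
theorem sqrt_two_mul_zpow_le_of_forall_sqrt_one_sub_mul_abs_eval_le {P : ℝ[X]} (hP : P.Monic)
    {M : ℝ} (hM : 0 < M)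
    (h : ∀ x ∈ Set.Icc (-1 : ℝ) 1, Real.sqrt (1 - x) * |P.eval x| ≤ M) :
    Real.sqrt 2 * (2 : ℝ) ^ (-(P.natDegree : ℤ)) ≤ M := by
  set n := P.natDegree with hn
  have hs : 0 < Real.sqrt 2 := by positivity
  have hq : (1 - Polynomial.C (2 : ℝ) * X ^ 2).natDegree = 2 := by compute_degree!
  have hql : (1 - Polynomial.C (2 : ℝ) * X ^ 2).leadingCoeff = -2 := by
    rw [leadingCoeff, hq]
    simp [coeff_one]
  set Q : ℝ[X] := Polynomial.C ((-1) ^ n * (Real.sqrt 2 / M)) *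
    (X * P.comp (1 - Polynomial.C 2 * X ^ 2)) with hQ
  have hlead : Q.leadingCoeff = Real.sqrt 2 / M * 2 ^ n := by
    rw [hQ, leadingCoeff_mul, leadingCoeff_C, leadingCoeff_mul, leadingCoeff_X,
      leadingCoeff_comp (by rw [hq]; norm_num), hP.leadingCoeff, hql, ← hn, one_mul, one_mul,
      neg_pow (2 : ℝ) n]
    have h1 : ((-1 : ℝ) ^ n) * (-1) ^ n = 1 := by rw [← mul_pow]; norm_num
    linear_combination (Real.sqrt 2 / M * 2 ^ n) * h1
  have hdeg : Q.degree ≤ ((2 * n + 1 : ℕ) : WithBot ℕ) := by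
    refine natDegree_le_iff_degree_le.mp ((natDegree_C_mul_le _ _).trans
      (natDegree_mul_le.trans ?_))
    rw [natDegree_X, natDegree_comp, hq, ← hn]
    omega
  have hbound : ∀ y ∈ Set.Icc (-1 : ℝ) 1, |Q.eval y| ≤ 1 := by
    intro y hy
    have hy2 : y ^ 2 ≤ 1 := by nlinarith [hy.1, hy.2]
    have h2 := h (1 - 2 * y ^ 2) ⟨by linarith, by linarith [sq_nonneg y]⟩
    rw [show 1 - (1 - 2 * y ^ 2) = 2 * y ^ 2 by ring, Real.sqrt_mul zero_le_two,
      Real.sqrt_sq_eq_abs] at h2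
    have h3 : |Q.eval y| = Real.sqrt 2 * |y| * |P.eval (1 - 2 * y ^ 2)| / M := by
      simp [hQ, abs_mul, abs_div, abs_of_pos hM, abs_of_pos hs, eval_comp]
      ring
    rw [h3]
    exact (div_le_one hM).mpr h2
  have key := leadingCoeff_le_of_forall_abs_le_one hdeg hbound
  rw [hlead, show 2 * n + 1 - 1 = n + n by omega, pow_add] at key
  have h4 : Real.sqrt 2 / M ≤ 2 ^ n := le_of_mul_le_mul_right key (by positivity)
  rw [zpow_neg, zpow_natCast, ← div_eq_mul_inv, div_le_iff₀ (by positivity), mul_comm]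
  exact (div_le_iff₀ hM).mp h4

theorem eval_cos_two_mul_U_add_U_mul_sin (n : ℕ) (φ : ℝ) (hφ : cos φ ≠ 0) :
    (U ℝ n + U ℝ ((n : ℤ) - 1)).eval (cos (2 * φ)) * sin φ = sin ((2 * n + 1) * φ) := by
  have h1 := U_real_cos (2 * φ) n
  have h2 := U_real_cos (2 * φ) ((n : ℤ) - 1)
  push_cast at h1 h2
  rw [sin_two_mul, show ((n : ℝ) + 1) * (2 * φ) = (2 * n + 1) * φ + φ by ring, sin_add] at h1
  rw [sin_two_mul, show ((n : ℝ) - 1 + 1) * (2 * φ) = (2 * n + 1) * φ - φ by ring, sin_sub] at h2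
  rw [eval_add]
  refine mul_right_cancel₀ hφ ?_
  linear_combination (h1 + h2) / 2

theorem abs_eval_neg_one_U_add_U (n : ℕ) :
    |(U ℝ n + U ℝ ((n : ℤ) - 1)).eval (-1)| = 1 := by
  rw [eval_add, U_eval_neg_one, U_eval_neg_one, Int.negOnePow_sub]
  simp only [Int.negOnePow_one, mul_neg, mul_one, Units.val_neg, Int.cast_neg, Int.cast_sub,
    Int.cast_natCast, Int.cast_one]
  rw [show ∀ a : ℝ, a * (n + 1) + -a * (n - 1 + 1) = a from fun a => by ring]
  rcases Int.even_or_odd (n : ℤ) with h | h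
  · simp [Int.negOnePow_even _ h]
  · simp [Int.negOnePow_odd _ h]

theorem sqrt_one_sub_mul_abs_eval_U_add_U_le (n : ℕ) {x : ℝ} (hx : x ∈ Set.Icc (-1 : ℝ) 1) :
    Real.sqrt (1 - x) * |(U ℝ n + U ℝ ((n : ℤ) - 1)).eval x| ≤ Real.sqrt 2 := by
  obtain ⟨φ, rfl⟩ : ∃ φ, x = cos (2 * φ) :=
    ⟨arccos x / 2, by rw [mul_div_cancel₀ _ two_ne_zero, cos_arccos hx.1 hx.2]⟩
  by_cases hφ : cos φ = 0
  · rw [show cos (2 * φ) = -1 by rw [cos_two_mul, hφ]; norm_num, abs_eval_neg_one_U_add_U]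
    norm_num
  · rw [show 1 - cos (2 * φ) = 2 * sin φ ^ 2 by rw [cos_two_mul, sin_sq]; ring,
      Real.sqrt_mul zero_le_two, Real.sqrt_sq_eq_abs, mul_assoc, ← abs_mul, mul_comm (sin φ),
      eval_cos_two_mul_U_add_U_mul_sin n φ hφ]
    exact mul_le_of_le_one_right (Real.sqrt_nonneg _) (abs_sin_le_one _)

theorem chebyshev_fourth_kind_weighted_sup_optimal (n : ℕ) (hn : 1 ≤ n) :
    (∀ P : ℝ[X], P.Monic → P.natDegree = n →
      Real.sqrt 2 * (2 : ℝ) ^ (-(n : ℤ)) ≤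
        ⨆ x : Set.Icc (-1:ℝ) 1, Real.sqrt (1 - (x : ℝ)) * |P.eval (x : ℝ)|) ∧
    (⨆ x : Set.Icc (-1:ℝ) 1,
        Real.sqrt (1 - (x : ℝ)) *
          |(C (((2 : ℝ) ^ n)⁻¹) *
              (Chebyshev.U ℝ n + Chebyshev.U ℝ ((n : ℤ) - 1))).eval (x : ℝ)|
      = Real.sqrt 2 * (2 : ℝ) ^ (-(n : ℤ))) := by
  constructor
  · rintro P hP rfl
    refine le_of_forall_gt_imp_ge_of_dense fun M hM => ?_
    refine sqrt_two_mul_zpow_le_of_forall_sqrt_one_sub_mul_abs_eval_le hP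
      ((Real.iSup_nonneg fun x => by positivity).trans_lt hM) fun x hx => ?_
    exact (le_ciSup (bddAbove_range_sqrt_one_sub_mul_abs_eval P) ⟨x, hx⟩).trans hM.le
  · have : Nonempty (Set.Icc (-1 : ℝ) 1) := ⟨⟨-1, by norm_num⟩⟩
    have h_scale : ∀ x : ℝ, Real.sqrt (1 - x) * |(Polynomial.C (((2 : ℝ) ^ n)⁻¹) *
        (U ℝ n + U ℝ ((n : ℤ) - 1))).eval x| =
        Real.sqrt (1 - x) * |(U ℝ n + U ℝ ((n : ℤ) - 1)).eval x| * (2 : ℝ) ^ (-(n : ℤ)) := by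
      intro x
      rw [eval_mul, eval_C, abs_mul, abs_of_pos (by positivity), zpow_neg, zpow_natCast]
      ring
    refine le_antisymm (ciSup_le fun x => ?_) ?_
    · rw [h_scale]
      exact mul_le_mul_of_nonneg_right (sqrt_one_sub_mul_abs_eval_U_add_U_le n x.2) (by positivity)
    · refine le_trans (le_of_eq ?_)
        (le_ciSup (bddAbove_range_sqrt_one_sub_mul_abs_eval _) ⟨-1, by norm_num⟩)
      rw [h_scale, abs_eval_neg_one_U_add_U]
      norm_num
end

section
/- Let -1 < b ≤ 1 and n ≥ 1. For every monic polynomial P with real coefficients of degree n, sup_{x ∈ [-1,b]} √(1+x) |P(x)| ≥ √(1+b) · ((1+b)/4)^n, and equality holds for the monic polynomial P(x) = ((1+b)/4)^n · (U_n - U_{n-1})((2x+1-b)/(1+b)), where U_k is the Chebyshev polynomial of the second kind. -/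
open Polynomial Real Polynomial.Chebyshev

namespace Polynomial.Chebyshev

theorem X_mul_U_sub_U_comp (R : Type*) [CommRing R] (n : ℤ) :
    X * (U R n - U R (n - 1)).comp (2 * X ^ 2 - 1) = T R (2 * n + 1) := by
  have recurrence (m : ℤ) : T R (m + 2) = 2 * (2 * X ^ 2 - 1) * T R m - T R (m - 2) := by
    have h := T_mul_T R m 2
    rw [T_two] at h
    linear_combination -h
  induction n using Polynomial.Chebyshev.induct with
  | zero => simp
  | one =>
    have h := recurrence 1
    norm_num at h ⊢
    rw [h]
    ring
  | add_two n ih1 ih2 =>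
    have h := recurrence (2 * (n + 1) + 1)
    rw [show (2 * ((n : ℤ) + 1) + 1 + 2) = 2 * (n + 2) + 1 by ring,
      show (2 * ((n : ℤ) + 1) + 1 - 2) = 2 * n + 1 by ring, ← ih1, ← ih2] at h
    rw [h, show (n : ℤ) + 2 - 1 = n - 1 + 2 by ring, U_add_two, U_add_two]
    simp only [sub_comp, mul_comp, X_comp, ofNat_comp,
      show (n : ℤ) - 1 + 1 = n by ring, show (n : ℤ) + 1 - 1 = n by ring]
    ring
  | neg_add_one n ih1 ih2 =>
    have h := recurrence (2 * (-n) + 1)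
    rw [show (2 * (-(n : ℤ)) + 1 + 2) = 2 * (-n + 1) + 1 by ring,
      show (2 * (-(n : ℤ)) + 1 - 2) = 2 * (-n - 1) + 1 by ring, ← ih1, ← ih2] at h
    have h' : T R (2 * (-n - 1) + 1) = 2 * (2 * X ^ 2 - 1) *
        (X * (U R (-n) - U R (-n - 1)).comp (2 * X ^ 2 - 1)) -
        X * (U R (-n + 1) - U R (-n + 1 - 1)).comp (2 * X ^ 2 - 1) := by
      linear_combination h
    rw [h', U_sub_one R (-n - 1), U_add_one R (-n)]
    simp only [sub_comp, mul_comp, X_comp, ofNat_comp,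
      show -(n : ℤ) - 1 + 1 = -n by ring, show -(n : ℤ) + 1 - 1 = -n by ring]
    ring

theorem natDegree_and_leadingCoeff_U_sub_U (n : ℕ) : (U ℝ n - U ℝ ((n : ℤ) - 1)).natDegree = n ∧
    (U ℝ n - U ℝ ((n : ℤ) - 1)).leadingCoeff = 2 ^ n := by
  have hlt : (U ℝ ((n : ℤ) - 1)).degree < (U ℝ n).degree := by
    rw [degree_U_natCast]
    cases n with
    | zero => simp
    | succ k =>
      rw [Nat.cast_succ, add_sub_cancel_right, degree_U_natCast]
      exact_mod_cast Nat.lt_succ_self k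
  refine ⟨?_, ?_⟩
  · rw [natDegree_eq_of_degree_eq (degree_sub_eq_left_of_degree_lt hlt), natDegree_U_natCast]
  · rw [leadingCoeff_sub_of_degree_lt hlt, leadingCoeff_U_natCast]

end Polynomial.Chebyshev

/-- The quadratic substitution `x = c * y ^ 2 - 1` turns the weight `√(1 + x)` into `√c * |y|`. -/
theorem Polynomial.sqrt_one_add_mul_abs_eval_quadratic (P : ℝ[X]) {c : ℝ} (hc : 0 ≤ c) (y : ℝ) :
    √(1 + (c * y ^ 2 - 1)) * |P.eval (c * y ^ 2 - 1)| =
      √c * |(X * P.comp (C c * X ^ 2 - 1)).eval y| := by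
  rw [add_sub_cancel, Real.sqrt_mul hc, Real.sqrt_sq_eq_abs]
  simp [abs_mul, mul_assoc]

theorem Polynomial.Monic.sqrt_mul_div_pow_le_of_forall_weighted_le {P : ℝ[X]} (hP : P.Monic)
    {c M : ℝ} (hc : 0 < c)
    (hM : ∀ x ∈ Set.Icc (-1) (c - 1), √(1 + x) * |P.eval x| ≤ M) :
    √c * (c / 4) ^ P.natDegree ≤ M := by
  set n := P.natDegree with hn
  have hquad : (C c * X ^ 2 - 1 : ℝ[X]).natDegree = 2 := by
    compute_degree!
    exact hc.ne'
  have hquadlc : (C c * X ^ 2 - 1 : ℝ[X]).leadingCoeff = c := by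
    rw [Polynomial.leadingCoeff, hquad]; simp [coeff_one]
  set Q : ℝ[X] := X * P.comp (C c * X ^ 2 - 1) with hQ
  have hlc : Q.leadingCoeff = c ^ n := by
    rw [hQ, leadingCoeff_mul, leadingCoeff_comp (by rw [hquad]; norm_num), hP, hquadlc]
    simp [hn]
  have hQ0 : Q ≠ 0 := by
    rw [← leadingCoeff_ne_zero, hlc]; positivity
  have hdeg : Q.natDegree = 2 * n + 1 := by
    rw [hQ, Polynomial.natDegree_mul X_ne_zero (right_ne_zero_of_mul hQ0), Polynomial.natDegree_comp, hquad, natDegree_X]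
    ring
  have hs : 0 < √c := Real.sqrt_pos.2 hc
  have hQM (y : ℝ) (hy : y ∈ Set.Icc (-1) 1) : √c * |Q.eval y| ≤ M := by
    rw [hQ, ← P.sqrt_one_add_mul_abs_eval_quadratic hc.le]
    have hy2 : y ^ 2 ≤ 1 := by nlinarith [hy.1, hy.2]
    exact hM _ ⟨by nlinarith [mul_nonneg hc.le (sq_nonneg y)], by nlinarith⟩
  have hM0 : 0 < M := by
    by_contra! hneg
    refine hQ0 (eq_zero_of_infinite_isRoot Q ((Set.Icc_infinite (by norm_num : (-1 : ℝ) < 1)).mono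
      fun y hy ↦ ?_))
    have : |Q.eval y| ≤ 0 := by
      by_contra! h
      nlinarith [hQM y hy, mul_pos hs h]
    exact abs_nonpos_iff.1 this
  have hle := leadingCoeff_le_of_forall_abs_le_one (n := 2 * n + 1) (P := C (√c / M) * Q)
    ((degree_C_mul (by positivity)).trans_le (degree_le_of_natDegree_le hdeg.le)) fun y hy ↦ by
      rw [eval_mul, eval_C, abs_mul, abs_of_pos (by positivity), div_mul_eq_mul_div,
        div_le_one hM0]
      exact hQM y hy
  rw [leadingCoeff_mul, leadingCoeff_C, hlc, add_tsub_cancel_right, pow_mul, div_mul_eq_mul_div,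
    div_le_iff₀ hM0] at hle
  norm_num at hle
  rw [div_pow, ← mul_div_assoc, div_le_iff₀ (by positivity)]
  linarith

theorem chebyshev_third_kind_weighted_sup_optimal_interval
    (b : ℝ) (hb1 : -1 < b) (hb2 : b ≤ 1) (n : ℕ) (hn : 1 ≤ n) :
    (∀ P : ℝ[X], P.Monic → P.natDegree = n →
      Real.sqrt (1 + b) * ((1 + b) / 4) ^ n ≤
        ⨆ x : Set.Icc (-1:ℝ) b, Real.sqrt (1 + (x : ℝ)) * |P.eval (x : ℝ)|) ∧
    ((C (((1 + b) / 4) ^ n) *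
        (Chebyshev.U ℝ n - Chebyshev.U ℝ ((n : ℤ) - 1)).comp
          (C (2 / (1 + b)) * X + C ((1 - b) / (1 + b)))).Monic ∧
      ⨆ x : Set.Icc (-1:ℝ) b,
        Real.sqrt (1 + (x : ℝ)) *
          |(C (((1 + b) / 4) ^ n) *
              (Chebyshev.U ℝ n - Chebyshev.U ℝ ((n : ℤ) - 1)).comp
                (C (2 / (1 + b)) * X + C ((1 - b) / (1 + b)))).eval (x : ℝ)|
        = Real.sqrt (1 + b) * ((1 + b) / 4) ^ n) := by
  have hc : 0 < 1 + b := by linarith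
  have hmem : b ∈ Set.Icc (-1) b := ⟨hb1.le, le_rfl⟩
  have : Nonempty (Set.Icc (-1) b) := ⟨⟨b, hmem⟩⟩
  refine ⟨fun P hP hdeg ↦ ?_, ?_, ?_⟩
  · have hbdd : BddAbove (Set.range fun x : Set.Icc (-1) b ↦ √(1 + (x : ℝ)) * |P.eval (x : ℝ)|) :=
      (isCompact_range (by fun_prop)).bddAbove
    rw [← hdeg]
    exact hP.sqrt_mul_div_pow_le_of_forall_weighted_le hc fun x hx ↦
      le_ciSup hbdd ⟨x, by simpa using hx⟩
  · have h2 : 2 / (1 + b) ≠ 0 := by positivity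
    obtain ⟨hd, hl⟩ := natDegree_and_leadingCoeff_U_sub_U n
    rw [Monic, leadingCoeff_mul, leadingCoeff_C,
      leadingCoeff_comp (by rw [natDegree_linear h2]; exact one_ne_zero), hl, hd,
      leadingCoeff_linear h2, ← mul_pow, ← mul_pow]
    field_simp
    norm_num
  · have key (y : ℝ) : √(1 + ((1 + b) * y ^ 2 - 1)) * |(C (((1 + b) / 4) ^ n) *
        (U ℝ n - U ℝ ((n : ℤ) - 1)).comp
          (C (2 / (1 + b)) * X + C ((1 - b) / (1 + b)))).eval ((1 + b) * y ^ 2 - 1)| =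
        √(1 + b) * ((1 + b) / 4) ^ n * |(T ℝ (2 * n + 1)).eval y| := by
      have harg : 2 / (1 + b) * ((1 + b) * y ^ 2 - 1) + (1 - b) / (1 + b) = 2 * y ^ 2 - 1 := by
        field_simp
        ring
      rw [← X_mul_U_sub_U_comp, sqrt_one_add_mul_abs_eval_quadratic _ hc.le, mul_assoc]
      congr 1
      rw [← abs_of_pos (show 0 < ((1 + b) / 4) ^ n by positivity), ← abs_mul,
        abs_of_pos (show 0 < ((1 + b) / 4) ^ n by positivity)]
      simp only [eval_mul, eval_comp, eval_add, eval_sub, eval_C, eval_X, eval_pow, eval_one,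
        eval_ofNat, harg]
      congr 1
      ring
    refine le_antisymm (ciSup_le fun ⟨x, hx⟩ ↦ ?_) ?_
    · have hq0 : 0 ≤ (1 + x) / (1 + b) := div_nonneg (by linarith [hx.1]) hc.le
      have hq1 : (1 + x) / (1 + b) ≤ 1 := (div_le_one hc).2 (by linarith [hx.2])
      have hx' : x = (1 + b) * √((1 + x) / (1 + b)) ^ 2 - 1 := by
        rw [Real.sq_sqrt hq0]
        field_simp
        ring
      dsimp only
      rw [hx', key]
      refine mul_le_of_le_one_right (by positivity) (abs_eval_T_real_le_one _ ?_)
      rw [abs_of_nonneg (Real.sqrt_nonneg _)]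
      exact Real.sqrt_le_one.2 hq1
    · have hb := key 1
      simp only [one_pow, mul_one, add_sub_cancel_left, T_eval_one, abs_one] at hb
      rw [← hb]
      exact le_ciSup (f := fun x : Set.Icc (-1) b ↦ √(1 + (x : ℝ)) *
        |(C (((1 + b) / 4) ^ n) * (U ℝ n - U ℝ ((n : ℤ) - 1)).comp
          (C (2 / (1 + b)) * X + C ((1 - b) / (1 + b)))).eval (x : ℝ)|)
        (isCompact_range (by fun_prop)).bddAbove ⟨b, hmem⟩
end

section
/- Let -1 ≤ a < 1 and n ≥ 1. For every monic polynomial P with real coefficients of degree n, sup_{x ∈ [a,1]} √(1-x) |P(x)| ≥ √(1-a) · ((1-a)/4)^n, and equality holds for the monic polynomial P(x) = ((1-a)/4)^n · (U_n + U_{n-1})((2x-1-a)/(1-a)), where U_k is the Chebyshev polynomial of the second kind. -/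
open Polynomial Real Polynomial.Chebyshev

theorem coeff_le_of_forall_abs_le {n : ℕ} {P : ℝ[X]} {B : ℝ}
    (hdeg : P.degree ≤ n) (hP : ∀ x ∈ Set.Icc (-1 : ℝ) 1, |P.eval x| ≤ B) :
    P.coeff n ≤ B * 2 ^ (n - 1) := by
  have hB : 0 ≤ B := (abs_nonneg _).trans (hP 0 (by norm_num))
  rcases hB.eq_or_lt with rfl | hB
  · have hinf : {x : ℝ | P.IsRoot x}.Infinite :=
      (Set.Icc_infinite (by norm_num : (-1 : ℝ) < 1)).mono fun x hx =>
        abs_nonpos_iff.mp (hP x hx)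
    simp [P.eq_zero_of_infinite_isRoot hinf]
  · have h := coeff_le_of_forall_abs_le_one (n := n) (P := Polynomial.C B⁻¹ * P)
      ((degree_C_mul (inv_ne_zero hB.ne')).le.trans hdeg) fun x hx => by
        rw [eval_C_mul, abs_mul, abs_of_pos (inv_pos.mpr hB), inv_mul_le_iff₀ hB, mul_one]
        exact hP x hx
    rwa [coeff_C_mul, inv_mul_le_iff₀ hB] at h

theorem le_of_forall_sqrt_mul_abs_eval_le {a M : ℝ} (ha : a < 1) {P : ℝ[X]} (hP : P.Monic)
    (hM : ∀ x ∈ Set.Icc a 1, √(1 - x) * |P.eval x| ≤ M) :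
    √(1 - a) * ((1 - a) / 4) ^ P.natDegree ≤ M := by
  set n := P.natDegree with hn
  have ha' : 0 < 1 - a := sub_pos.mpr ha
  have hM0 : 0 ≤ M := le_trans (by positivity) (hM a ⟨le_rfl, ha.le⟩)
  set L : ℝ[X] := Polynomial.C ((1 - a) / 2) * X + Polynomial.C ((1 + a) / 2) with hL
  have hc : (1 - a) / 2 ≠ 0 := by positivity
  have hLdeg : L.natDegree = 1 := natDegree_linear hc
  have hmonic : ((X - Polynomial.C 1) * P ^ 2).Monic := (monic_X_sub_C 1).mul (hP.pow 2)
  have hdeg : ((X - Polynomial.C 1) * P ^ 2).natDegree = 2 * n + 1 := by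
    rw [(monic_X_sub_C 1).natDegree_mul (hP.pow 2), natDegree_X_sub_C, hP.natDegree_pow]
    ring
  set R : ℝ[X] := ((X - Polynomial.C 1) * P ^ 2).comp L with hR
  have hRdeg : R.natDegree = 2 * n + 1 := by rw [hR, natDegree_comp, hdeg, hLdeg, mul_one]
  have hRcoeff : R.coeff (2 * n + 1) = ((1 - a) / 2) ^ (2 * n + 1) := by
    rw [← hRdeg, coeff_natDegree, hR, leadingCoeff_comp (by simp [hLdeg]), hmonic.leadingCoeff,
      hL, leadingCoeff_linear hc, ← hL, hdeg, one_mul, natDegree_comp, hLdeg, hdeg, mul_one]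
  have hdeg' : (R + Polynomial.C (M ^ 2 / 2)).degree ≤ ((2 * n + 1 : ℕ) : WithBot ℕ) :=
    degree_le_of_natDegree_le (by rw [natDegree_add_C, hRdeg])
  have hbound := coeff_le_of_forall_abs_le (B := M ^ 2 / 2) hdeg' fun y hy => by
    have hx : L.eval y ∈ Set.Icc a 1 := by
      simp only [hL, eval_add, eval_mul, eval_C, eval_X]
      constructor <;> nlinarith [hy.1, hy.2]
    have hsq := pow_le_pow_left₀ (by positivity) (hM _ hx) 2
    rw [mul_pow, sq_sqrt (sub_nonneg.mpr hx.2), sq_abs] at hsq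
    have hnn := mul_nonneg (sub_nonneg.mpr hx.2) (sq_nonneg (P.eval (L.eval y)))
    simp only [hR, eval_add, eval_comp, eval_mul, eval_sub, eval_X, eval_C, eval_pow]
    rw [abs_le]
    constructor <;> linarith
  rw [coeff_add, hRcoeff, coeff_C_succ, add_zero, Nat.add_sub_cancel] at hbound
  refine le_of_sq_le_sq ?_ hM0
  have h4 : ((1 - a) / 4) ^ n = ((1 - a) / 2) ^ n / 2 ^ n := by
    rw [← div_pow]; ring
  rw [mul_pow, sq_sqrt ha'.le, h4, div_pow, ← pow_mul, ← pow_mul, mul_comm n 2, ← mul_div_assoc,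
    div_le_iff₀ (by positivity)]
  rw [pow_succ] at hbound
  linarith

theorem one_sub_mul_eval_U_add_U_sub_one_sq_le (n : ℕ) {y : ℝ} (hy : y ∈ Set.Icc (-1 : ℝ) 1) :
    (1 - y) * (Chebyshev.U ℝ n + Chebyshev.U ℝ ((n : ℤ) - 1)).eval y ^ 2 ≤ 2 := by
  rcases hy.1.eq_or_lt with rfl | hy1
  · have h : ((Chebyshev.U ℝ n + Chebyshev.U ℝ ((n : ℤ) - 1)).eval (-1)) ^ 2 = 1 := by
      rw [eval_add, U_eval_neg_one, U_eval_neg_one, Int.negOnePow_sub, Int.negOnePow_one]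
      rcases Int.even_or_odd n with h | h
      · simp [Int.negOnePow_even _ h]
      · simp [Int.negOnePow_odd _ h]
    rw [h]; norm_num
  · obtain ⟨θ, rfl⟩ : ∃ θ, cos θ = y := ⟨arccos y, cos_arccos hy.1 hy.2⟩
    set w := (Chebyshev.U ℝ n + Chebyshev.U ℝ ((n : ℤ) - 1)).eval (cos θ) with hw
    have hws : w * sin θ = sin ((n + 1) * θ) + sin (n * θ) := by
      rw [hw, eval_add, add_mul, U_real_cos, U_real_cos]
      simp
    have hsum : (sin ((n + 1) * θ) + sin (n * θ)) ^ 2 =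
        (1 - cos ((n + 1) * θ + n * θ)) * (1 + cos θ) := by
      have hθ : cos θ = cos ((n + 1) * θ - n * θ) := by ring_nf
      rw [hθ, cos_add, cos_sub]
      linear_combination cos (n * θ) ^ 2 * sin_sq_add_cos_sq ((n + 1) * θ) +
        (1 - sin ((n + 1) * θ) ^ 2) * sin_sq_add_cos_sq (n * θ)
    have hsq : (1 - cos θ) * w ^ 2 * (1 + cos θ) =
        (1 - cos ((n + 1) * θ + n * θ)) * (1 + cos θ) := by
      rw [← hsum, ← hws, mul_pow, sin_sq]; ring
    have hpos : 0 < 1 + cos θ := by linarith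
    rw [mul_right_cancel₀ hpos.ne' hsq]
    linarith [neg_one_le_cos ((n + 1) * θ + n * θ)]

theorem monic_chebyshev_fourth_kind_comp {a : ℝ} (ha : a < 1) {n : ℕ} (hn : 1 ≤ n) :
    (Polynomial.C (((1 - a) / 4) ^ n) *
      (Chebyshev.U ℝ n + Chebyshev.U ℝ ((n : ℤ) - 1)).comp
        (Polynomial.C (2 / (1 - a)) * X + Polynomial.C ((-1 - a) / (1 - a)))).Monic ∧
    (Polynomial.C (((1 - a) / 4) ^ n) *
      (Chebyshev.U ℝ n + Chebyshev.U ℝ ((n : ℤ) - 1)).comp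
        (Polynomial.C (2 / (1 - a)) * X + Polynomial.C ((-1 - a) / (1 - a)))).natDegree = n := by
  obtain ⟨m, rfl⟩ := Nat.exists_eq_add_of_le' hn
  have ha' : 0 < 1 - a := sub_pos.mpr ha
  have hc : 2 / (1 - a) ≠ 0 := by positivity
  have hd : ((1 - a) / 4) ^ (m + 1) ≠ 0 := by positivity
  have hcast : ((m + 1 : ℕ) : ℤ) - 1 = (m : ℕ) := by push_cast; ring
  rw [hcast]
  have hlt : (Chebyshev.U ℝ (m : ℕ)).degree < (Chebyshev.U ℝ (m + 1 : ℕ)).degree := by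
    rw [degree_U_natCast, degree_U_natCast]
    exact_mod_cast m.lt_succ_self
  have hWdeg : (Chebyshev.U ℝ (m + 1 : ℕ) + Chebyshev.U ℝ (m : ℕ)).natDegree = m + 1 := by
    rw [natDegree_add_eq_left_of_degree_lt hlt, natDegree_U_natCast]
  refine ⟨?_, ?_⟩
  · rw [Monic, leadingCoeff_mul, leadingCoeff_C, leadingCoeff_comp (by simp [natDegree_linear hc]),
      leadingCoeff_linear hc, hWdeg, leadingCoeff_add_of_degree_lt' hlt, leadingCoeff_U_natCast,
      ← mul_pow, ← mul_pow]
    convert one_pow (m + 1) using 2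
    field_simp
    norm_num
  · rw [natDegree_C_mul hd, natDegree_comp, hWdeg, natDegree_linear hc, mul_one]

theorem chebyshev_fourth_kind_weighted_sup_optimal_interval
    (a : ℝ) (ha1 : -1 ≤ a) (ha2 : a < 1) (n : ℕ) (hn : 1 ≤ n) :
    (∀ P : ℝ[X], P.Monic → P.natDegree = n →
      Real.sqrt (1 - a) * ((1 - a) / 4) ^ n ≤
        ⨆ x : Set.Icc a (1:ℝ), Real.sqrt (1 - (x : ℝ)) * |P.eval (x : ℝ)|) ∧
    ((C (((1 - a) / 4) ^ n) *
        (Chebyshev.U ℝ n + Chebyshev.U ℝ ((n : ℤ) - 1)).comp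
          (C (2 / (1 - a)) * X + C ((-1 - a) / (1 - a)))).Monic ∧
      ⨆ x : Set.Icc a (1:ℝ),
        Real.sqrt (1 - (x : ℝ)) *
          |(C (((1 - a) / 4) ^ n) *
              (Chebyshev.U ℝ n + Chebyshev.U ℝ ((n : ℤ) - 1)).comp
                (C (2 / (1 - a)) * X + C ((-1 - a) / (1 - a)))).eval (x : ℝ)|
        = Real.sqrt (1 - a) * ((1 - a) / 4) ^ n) := by
  have hsup : ∀ P : ℝ[X], P.Monic → P.natDegree = n →
      Real.sqrt (1 - a) * ((1 - a) / 4) ^ n ≤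
        ⨆ x : Set.Icc a (1:ℝ), Real.sqrt (1 - (x : ℝ)) * |P.eval (x : ℝ)| := by
    rintro P hP rfl
    have hbdd : BddAbove
        (Set.range fun x : Set.Icc a (1:ℝ) => Real.sqrt (1 - (x : ℝ)) * |P.eval (x : ℝ)|) :=
      (isCompact_range (by fun_prop)).bddAbove
    exact le_of_forall_sqrt_mul_abs_eval_le ha2 hP fun x hx => le_ciSup hbdd ⟨x, hx⟩
  obtain ⟨hmonic, hdeg⟩ := monic_chebyshev_fourth_kind_comp ha2 hn
  refine ⟨hsup, hmonic, le_antisymm ?_ (hsup _ hmonic hdeg)⟩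
  have : Nonempty (Set.Icc a (1:ℝ)) := ⟨⟨a, le_rfl, ha2.le⟩⟩
  refine ciSup_le fun ⟨x, hx⟩ => ?_
  have ha' : 0 < 1 - a := sub_pos.mpr ha2
  simp only [eval_mul, eval_C, eval_comp, eval_add, eval_X]
  rw [← eval_add]
  set y := 2 / (1 - a) * x + (-1 - a) / (1 - a) with hy
  have hxy : 1 - x = (1 - a) / 2 * (1 - y) := by rw [hy]; field_simp; ring
  have hy1 : y ∈ Set.Icc (-1 : ℝ) 1 := by
    constructor <;> nlinarith [hx.1, hx.2]
  have hW := one_sub_mul_eval_U_add_U_sub_one_sq_le n hy1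
  rw [abs_mul, abs_of_pos (by positivity), mul_left_comm, mul_comm]
  gcongr
  refine Real.le_sqrt_of_sq_le ?_
  rw [mul_pow, sq_sqrt (sub_nonneg.mpr hx.2), sq_abs, hxy]
  nlinarith
end

section
/- Let n ≥ 1 and let U_k denote the Chebyshev polynomial of the second kind. Then the set {z ∈ ℂ : (1+z)·((U_n - U_{n-1})(z))²/2 is real and lies in [0,1]} is exactly the real segment [-1,1], i.e. {z ∈ ℂ : Im z = 0 and -1 ≤ Re z ≤ 1}. -/
open Polynomial Polynomial.Chebyshev Complex

theorem one_add_mul_eval_U_sub_U_sq (n : ℤ) (z : ℂ) :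
    (1 + z) * ((Chebyshev.U ℂ n - Chebyshev.U ℂ (n - 1)).eval z) ^ 2
      = 1 + (Chebyshev.T ℂ (2 * n + 1)).eval z := by
  obtain ⟨θ, rfl⟩ := Complex.cos_surjective z
  obtain ⟨φ, rfl⟩ : ∃ φ, θ = 2 * φ := ⟨θ / 2, by ring⟩
  by_cases hs : sin φ = 0
  · have h1 : cos (2 * φ) = 1 := by
      rw [cos_two_mul, cos_sq', hs]
      norm_num
    simp only [h1, eval_sub, U_eval_one, T_eval_one]
    push_cast
    ring
  · have hU := U_complex_cos (2 * φ) n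
    have hU' := U_complex_cos (2 * φ) (n - 1)
    have hsub : sin ((n + 1) * (2 * φ)) - sin (((n - 1 : ℤ) + 1) * (2 * φ))
        = 2 * sin φ * cos ((2 * n + 1) * φ) := by
      rw [sin_sub_sin]
      push_cast
      ring_nf
    have hV : (Chebyshev.U ℂ n - Chebyshev.U ℂ (n - 1)).eval (cos (2 * φ)) * cos φ
        = cos ((2 * n + 1) * φ) := by
      apply mul_left_cancel₀ (mul_ne_zero two_ne_zero hs)
      rw [← hsub, ← hU, ← hU', sin_two_mul, eval_sub]
      ring
    have hT : (Chebyshev.T ℂ (2 * n + 1)).eval (cos (2 * φ))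
        = 2 * cos ((2 * n + 1) * φ) ^ 2 - 1 := by
      rw [T_complex_cos, ← cos_two_mul]
      push_cast
      ring_nf
    have hc : 1 + cos (2 * φ) = 2 * cos φ ^ 2 := by
      rw [cos_two_mul]
      ring
    rw [hT, ← hV, hc]
    ring

theorem exists_ofReal_eq_of_cos_eq_ofReal {w : ℂ} {c : ℝ} (hc : c ∈ Set.Icc (-1 : ℝ) 1)
    (h : cos w = c) : ∃ t : ℝ, w = t := by
  rw [← Real.cos_arccos hc.1 hc.2, ofReal_cos, eq_comm, cos_eq_cos_iff] at h
  obtain ⟨k, h | h⟩ := h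
  · exact ⟨2 * k * Real.pi + Real.arccos c, by rw [h]; push_cast; ring⟩
  · exact ⟨2 * k * Real.pi - Real.arccos c, by rw [h]; push_cast; ring⟩

theorem eval_T_complex_mem_ofReal_image_Icc_iff {m : ℤ} (hm : m ≠ 0) (z : ℂ) :
    (Chebyshev.T ℂ m).eval z ∈ ofReal '' Set.Icc (-1 : ℝ) 1 ↔
      z ∈ ofReal '' Set.Icc (-1 : ℝ) 1 := by
  constructor
  · rintro ⟨c, hc, h⟩
    obtain ⟨θ, rfl⟩ := Complex.cos_surjective z
    rw [T_complex_cos] at h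
    obtain ⟨t, ht⟩ := exists_ofReal_eq_of_cos_eq_ofReal hc h.symm
    have hm' : (m : ℂ) ≠ 0 := mod_cast hm
    refine ⟨Real.cos (t / m), Real.cos_mem_Icc _, ?_⟩
    push_cast
    rw [← ht, mul_div_cancel_left₀ _ hm']
  · rintro ⟨x, hx, rfl⟩
    exact ⟨_, eval_T_real_mem_Icc m hx, complex_ofReal_eval_T x m⟩

theorem mem_ofReal_image_Icc_iff {a b : ℝ} {z : ℂ} :
    z ∈ ofReal '' Set.Icc a b ↔ z.im = 0 ∧ a ≤ z.re ∧ z.re ≤ b := by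
  constructor
  · rintro ⟨x, hx, rfl⟩
    exact ⟨ofReal_im x, hx⟩
  · rintro ⟨h, hz⟩
    exact ⟨z.re, hz, Complex.ext rfl h.symm⟩

theorem preimage_unit_interval_third_kind (n : ℕ) (hn : 1 ≤ n) :
    {z : ℂ |
        ((1 + z) * ((Chebyshev.U ℂ n - Chebyshev.U ℂ ((n : ℤ) - 1)).eval z) ^ 2 / 2).im = 0 ∧
        ((1 + z) * ((Chebyshev.U ℂ n - Chebyshev.U ℂ ((n : ℤ) - 1)).eval z) ^ 2 / 2).re
          ∈ Set.Icc (0 : ℝ) 1}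
      = {z : ℂ | z.im = 0 ∧ -1 ≤ z.re ∧ z.re ≤ 1} := by
  ext z
  rw [Set.mem_ofPred_eq, Set.mem_ofPred_eq, one_add_mul_eval_U_sub_U_sq,
    ← mem_ofReal_image_Icc_iff,
    ← eval_T_complex_mem_ofReal_image_Icc_iff (m := 2 * n + 1) (by omega) z,
    mem_ofReal_image_Icc_iff, div_ofNat_im, div_ofNat_re, add_im, add_re, one_im, one_re,
    Set.mem_Icc]
  constructor <;> rintro ⟨h1, h2, h3⟩ <;> refine ⟨?_, ?_, ?_⟩ <;> linarith
end

section
/- Let n ≥ 1 and let U_k denote the Chebyshev polynomial of the second kind. Then the set {z ∈ ℂ : (1-z²)·(U_n(z))² is real and lies in [0,1]} is exactly the real segment [-1,1], i.e. {z ∈ ℂ : Im z = 0 and -1 ≤ Re z ≤ 1}. -/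
open Polynomial Polynomial.Chebyshev Complex

theorem sq_sin_mem_unit_interval_iff (w : ℂ) :
    ((sin w ^ 2).im = 0 ∧ (sin w ^ 2).re ∈ Set.Icc (0 : ℝ) 1) ↔ w.im = 0 := by
  obtain ⟨a, b⟩ := w
  have hre : (sin (⟨a, b⟩ : ℂ) ^ 2).re =
      (Real.sin a * Real.cosh b) ^ 2 - (Real.cos a * Real.sinh b) ^ 2 := by
    rw [sin_eq]
    simp [pow_two, sin_ofReal_re, cos_ofReal_re, sinh_ofReal_re, cosh_ofReal_re]
  have him : (sin (⟨a, b⟩ : ℂ) ^ 2).im =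
      2 * ((Real.sin a * Real.cosh b) * (Real.cos a * Real.sinh b)) := by
    rw [sin_eq]
    simp [pow_two, sin_ofReal_re, cos_ofReal_re, sinh_ofReal_re, cosh_ofReal_re]
    ring
  rw [hre, him, Set.mem_Icc]
  have hsc := Real.sin_sq_add_cos_sq a
  have hch := Real.cosh_sq b
  constructor
  · rintro ⟨h, h0, h1⟩
    refine Real.sinh_eq_zero.mp (pow_eq_zero_iff two_ne_zero |>.mp ?_)
    have hc := (Real.cosh_pos b).ne'
    rcases mul_eq_zero.mp h with h | h
    · norm_num at h
    rcases mul_eq_zero.mp h with h | h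
    · have hs : Real.sin a = 0 := (mul_eq_zero.mp h).resolve_right hc
      have hcos : Real.cos a ^ 2 = 1 := by simpa [hs] using hsc
      rw [h, mul_pow, hcos] at h0
      nlinarith [sq_nonneg (Real.sinh b)]
    · rcases mul_eq_zero.mp h with hcos | hsinh
      · have hs : Real.sin a ^ 2 = 1 := by simpa [hcos] using hsc
        rw [h, mul_pow, hs, hch] at h1
        nlinarith [sq_nonneg (Real.sinh b)]
      · simp [hsinh]
  · rintro (rfl : b = 0)
    simp only [Real.cosh_zero, Real.sinh_zero]
    exact ⟨by ring, by nlinarith [sq_nonneg (Real.sin a)], by nlinarith [sq_nonneg (Real.cos a)]⟩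

theorem one_sub_sq_mem_unit_interval_iff (z : ℂ) :
    ((1 - z ^ 2).im = 0 ∧ (1 - z ^ 2).re ∈ Set.Icc (0 : ℝ) 1) ↔
      z.im = 0 ∧ -1 ≤ z.re ∧ z.re ≤ 1 := by
  obtain ⟨x, y⟩ := z
  simp only [pow_two, sub_im, sub_re, mul_im, mul_re, one_im, one_re, Set.mem_Icc]
  constructor
  · rintro ⟨h, h0, h1⟩
    have hxy : x * y = 0 := by linarith
    have hy : y = 0 := by
      rcases mul_eq_zero.mp hxy with rfl | hy
      · nlinarith [sq_nonneg y]
      · exact hy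
    subst hy
    exact ⟨rfl, by nlinarith, by nlinarith⟩
  · rintro ⟨rfl, h0, h1⟩
    exact ⟨by ring, by nlinarith, by nlinarith [sq_nonneg x]⟩

theorem preimage_unit_interval_second_kind (n : ℕ) (hn : 1 ≤ n) :
    {z : ℂ |
        ((1 - z ^ 2) * ((Chebyshev.U ℂ n).eval z) ^ 2).im = 0 ∧
        ((1 - z ^ 2) * ((Chebyshev.U ℂ n).eval z) ^ 2).re ∈ Set.Icc (0 : ℝ) 1}
      = {z : ℂ | z.im = 0 ∧ -1 ≤ z.re ∧ z.re ≤ 1} := by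
  ext z
  obtain ⟨w, rfl⟩ := cos_surjective z
  have hsin : 1 - cos w ^ 2 = sin w ^ 2 := by rw [sin_sq]
  have hU : (1 - cos w ^ 2) * ((Chebyshev.U ℂ n).eval (cos w)) ^ 2 =
      sin (((n + 1 : ℝ) : ℂ) * w) ^ 2 := by
    have h := U_complex_cos w n
    push_cast at h ⊢
    rw [← h, hsin]
    ring
  have hn' : (n + 1 : ℝ) ≠ 0 := by positivity
  rw [Set.mem_ofPred_eq, Set.mem_ofPred_eq, ← one_sub_sq_mem_unit_interval_iff, hU, hsin,
    sq_sin_mem_unit_interval_iff, sq_sin_mem_unit_interval_iff, im_ofReal_mul,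
    mul_eq_zero, or_iff_right hn']
end

section
/- Let K be an infinite compact subset of [-1,1], let n ≥ 1, and let T be a monic polynomial with real coefficients of degree n such that sup_{x ∈ K} √(1+x)|T(x)| ≤ sup_{x ∈ K} √(1+x)|P(x)| for every monic polynomial P with real coefficients of degree n. Then every complex root of T is real. -/
open Polynomial Real

/-- A continuous weight whose zeros are finite in number gives every nonzero polynomial a positive
weighted sup-norm on an infinite compact set. -/
theorem sSup_weighted_abs_eval_pos {K : Set ℝ} (hKc : IsCompact K) (hKinf : K.Infinite)
    {w : ℝ → ℝ} (hw : Continuous w) (hw0 : ∀ x ∈ K, 0 ≤ w x) (hwz : {x ∈ K | w x = 0}.Finite)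
    {T : ℝ[X]} (hT : T ≠ 0) :
    0 < sSup ((fun x => w x * |T.eval x|) '' K) := by
  have hbdd : BddAbove ((fun x => w x * |T.eval x|) '' K) :=
    (hKc.image (by fun_prop)).bddAbove
  obtain ⟨x, hxK, hx⟩ := hKinf.exists_notMem_finite (hwz.union T.roots.toFinset.finite_toSet)
  simp only [Set.mem_union, Set.mem_ofPred_eq, Finset.mem_coe, Multiset.mem_toFinset, mem_roots hT,
    IsRoot.def, not_or, not_and] at hx
  have hwx : 0 < w x := (hw0 x hxK).lt_of_ne' (hx.1 hxK)
  exact (mul_pos hwx (abs_pos.mpr hx.2)).trans_le (le_csSup hbdd ⟨x, hxK, rfl⟩)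

/-- On `[-1, 1]`, dropping the constant `b ^ 2` from `(x - a) ^ 2 + b ^ 2` shrinks it by a uniform
factor. -/
theorem sub_sq_le_mul_sub_sq_add_sq {a b x : ℝ} (hx : x ∈ Set.Icc (-1 : ℝ) 1) :
    (x - a) ^ 2 ≤ (1 + |a|) ^ 2 / ((1 + |a|) ^ 2 + b ^ 2) * ((x - a) ^ 2 + b ^ 2) := by
  have hxa : |x - a| ≤ 1 + |a| := (abs_sub x a).trans (by gcongr; exact abs_le.mpr hx)
  have hsq : (x - a) ^ 2 ≤ (1 + |a|) ^ 2 := sq_le_sq' (abs_le.mp hxa).1 (abs_le.mp hxa).2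
  rw [div_mul_eq_mul_div, le_div_iff₀ (by positivity)]
  nlinarith [mul_le_mul_of_nonneg_right hsq (sq_nonneg b)]

theorem weighted_chebyshev_roots_real
    (K : Set ℝ) (hK : K ⊆ Set.Icc (-1:ℝ) 1) (hKc : IsCompact K) (hKinf : K.Infinite)
    (n : ℕ) (hn : 1 ≤ n)
    (T : ℝ[X]) (hT : T.Monic) (hdeg : T.natDegree = n)
    (hmin : ∀ P : ℝ[X], P.Monic → P.natDegree = n →
      sSup ((fun x => Real.sqrt (1 + x) * |T.eval x|) '' K) ≤
        sSup ((fun x => Real.sqrt (1 + x) * |P.eval x|) '' K))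
    (z : ℂ) (hz : (Polynomial.aeval z) T = 0) :
    z.im = 0 := by
  by_contra him
  have hpos : 0 < sSup ((fun x => √(1 + x) * |T.eval x|) '' K) := by
    refine sSup_weighted_abs_eval_pos hKc hKinf (by fun_prop) (fun x _ => sqrt_nonneg _)
      ((Set.finite_singleton (-1 : ℝ)).subset ?_) hT.ne_zero
    rintro x ⟨hxK, hx⟩
    have := (sqrt_eq_zero (by linarith [(hK hxK).1])).mp hx
    exact eq_neg_of_add_eq_zero_right this
  have hbdd : BddAbove ((fun x => √(1 + x) * |T.eval x|) '' K) :=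
    (hKc.image (by fun_prop)).bddAbove
  obtain ⟨R, hR⟩ := T.quadratic_dvd_of_aeval_eq_zero_im_ne_zero hz him
  have hQ : (X ^ 2 - C (2 * z.re) * X + C (‖z‖ ^ 2) : ℝ[X]).Monic := by monicity!
  have hQdeg : (X ^ 2 - C (2 * z.re) * X + C (‖z‖ ^ 2) : ℝ[X]).natDegree = 2 := by
    compute_degree!
  have hRm : R.Monic := hQ.of_mul_monic_left (hR ▸ hT)
  have hsq : ((X - C z.re) ^ 2 : ℝ[X]).Monic := (monic_X_sub_C _).pow 2
  have hPdeg : ((X - C z.re) ^ 2 * R).natDegree = n := by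
    rw [hsq.natDegree_mul hRm, natDegree_pow, natDegree_X_sub_C, ← hdeg, hR,
      hQ.natDegree_mul hRm, hQdeg]
  have hle := hmin _ (hsq.mul hRm) hPdeg
  set c : ℝ := (1 + |z.re|) ^ 2 / ((1 + |z.re|) ^ 2 + z.im ^ 2) with hc
  have hc0 : 0 ≤ c := by positivity
  have hc1 : c < 1 := by
    rw [hc, div_lt_one (by positivity)]
    exact lt_add_of_pos_right _ (by positivity)
  have hcontract : sSup ((fun x => √(1 + x) * |((X - C z.re) ^ 2 * R).eval x|) '' K) ≤
      c * sSup ((fun x => √(1 + x) * |T.eval x|) '' K) := by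
    refine csSup_le (hKinf.nonempty.image _) ?_
    rintro _ ⟨x, hxK, rfl⟩
    have hTx : T.eval x = ((x - z.re) ^ 2 + z.im ^ 2) * R.eval x := by
      rw [hR, ← Complex.normSq_eq_norm_sq, Complex.normSq_apply]
      simp only [eval_mul, eval_add, eval_sub, eval_pow, eval_X, eval_C]
      ring
    calc √(1 + x) * |((X - C z.re) ^ 2 * R).eval x|
        = √(1 + x) * ((x - z.re) ^ 2 * |R.eval x|) := by simp [abs_mul]
      _ ≤ √(1 + x) * (c * ((x - z.re) ^ 2 + z.im ^ 2) * |R.eval x|) := by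
          gcongr
          exact sub_sq_le_mul_sub_sq_add_sq (hK hxK)
      _ = c * (√(1 + x) * |T.eval x|) := by
          rw [hTx, abs_mul, abs_of_nonneg (by positivity : 0 ≤ (x - z.re) ^ 2 + z.im ^ 2)]
          ring
      _ ≤ _ := mul_le_mul_of_nonneg_left (le_csSup hbdd ⟨x, hxK, rfl⟩) hc0
  exact (hle.trans hcontract).not_gt (mul_lt_of_lt_one_left hpos hc1)
end
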